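/- Let P, X, Y, Z be types with functions p : P → X, q : P → Y, f : X → Z, g : Y → Z satisfying f ∘ p = g ∘ q, and suppose the square is a pullback of types, i.e. the map P → {(x, y) : X × Y // f x = g y} sending t to (p t, q t) is a bijection. Then the induced 2-square of discrete categories — with vertex Discrete P, legs the functors of discrete categories induced by p, q, f, g, and 2-cell induced by the equality f ∘ p = g ∘ q — is Guitart exact. -/

import Mathlib

/-!
STATEMENT 3: A pullback square of types induces a Guitart exact 2-square of
discrete categories.
-/

open CategoryTheory

universe u₁ u₂ u₃ u₄

theorem discrete_pullback_guitartExact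
    {P : Type u₁} {X : Type u₂} {Y : Type u₃} {Z : Type u₄}
    (p : P → X) (q : P → Y) (f : X → Z) (g : Y → Z)
    (h : f ∘ p = g ∘ q)
    (hpb : Function.Bijective
      (fun t => (⟨(p t, q t), congrFun h t⟩ : { xy : X × Y // f xy.1 = g xy.2 }))) :
    (TwoSquare.mk
      (Discrete.functor (fun t => Discrete.mk (p t)))
      (Discrete.functor (fun t => Discrete.mk (q t)))
      (Discrete.functor (fun x => Discrete.mk (f x)))
      (Discrete.functor (fun y => Discrete.mk (g y)))
      (Discrete.natTrans (fun t =>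
        eqToHom (congrArg Discrete.mk (congrFun h t.as))))).GuitartExact := by
  rw [TwoSquare.guitartExact_iff_isConnected_rightwards]
  rintro ⟨x⟩ ⟨y⟩ e
  obtain ⟨t, ht⟩ := hpb.2 ⟨(x, y), Discrete.eq_of_hom e⟩
  have hx : p t = x := congrArg (fun s => s.1.1) ht
  have hy : q t = y := congrArg (fun s => s.1.2) ht
  refine @zigzag_isConnected _ _ ⟨TwoSquare.StructuredArrowRightwards.mk _ e ⟨t⟩
    (Discrete.eqToHom hx.symm) (Discrete.eqToHom hy) (Subsingleton.elim _ _)⟩ fun A B => ?_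
  obtain ⟨⟨t₁⟩, a₁, b₁, _, rfl⟩ := TwoSquare.StructuredArrowRightwards.mk_surjective A
  obtain ⟨⟨t₂⟩, a₂, b₂, _, rfl⟩ := TwoSquare.StructuredArrowRightwards.mk_surjective B
  obtain rfl : t₁ = t₂ := hpb.1 (Subtype.ext (Prod.ext
    ((Discrete.eq_of_hom a₁).symm.trans (Discrete.eq_of_hom a₂))
    ((Discrete.eq_of_hom b₁).trans (Discrete.eq_of_hom b₂).symm)))
  obtain rfl : a₁ = a₂ := Subsingleton.elim _ _
  obtain rfl : b₁ = b₂ := Subsingleton.elim _ _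
  exact Zigzag.refl _
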